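/- arXiv:2410.10717 — 8 statements merged into one kernel-verified Lean document; each statement's English description precedes it below -/
import Mathlib

section
/- Let G be a left unital associative semiloopoid over a nonempty set Λ equipped with a pre-braiding σ. Then σ satisfies the quiver-theoretic Yang–Baxter equation: (σ⊗id)(id⊗σ)(σ⊗id) = (id⊗σ)(σ⊗id)(id⊗σ) as maps on the set G⊗G⊗G of composable triples of arrows. -/
/-- A left unital associative semiloopoid over `Λ`: a quiver with arrow set `G`,
source `s`, target `t`, a multiplication defined (meaningfully) on composable pairs,
bijective left multiplications (witnessed by the left division `ldiv`), and
left/right units at every vertex in the image of `t`. -/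
structure LUAS (Λ : Type u) (G : Type v) where
  s : G → Λ
  t : G → Λ
  mul : G → G → G
  s_mul : ∀ x y, t x = s y → s (mul x y) = s x
  t_mul : ∀ x y, t x = s y → t (mul x y) = t y
  massoc : ∀ x y z, t x = s y → t y = s z → mul (mul x y) z = mul x (mul y z)
  ldiv : G → G → G
  s_ldiv : ∀ x y, s y = s x → s (ldiv x y) = t x
  mul_ldiv : ∀ x y, s y = s x → mul x (ldiv x y) = y
  ldiv_mul : ∀ x z, t x = s z → ldiv x (mul x z) = z
  one : Λ → G
  s_one : ∀ l, (∃ x, t x = l) → s (one l) = l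
  t_one : ∀ l, (∃ x, t x = l) → t (one l) = l
  mul_one : ∀ x, mul x (one (t x)) = x
  one_mul : ∀ y, (∃ x, t x = s y) → mul (one (s y)) y = y

/-- A pre-braiding on a left unital associative semiloopoid: a morphism of quivers
`σ(x ⊗ y) = (x ⇀ y) ⊗ (x ↼ y)` on composable pairs, satisfying (BG1), (BG2) for all
arrows between unital vertices, and (BG3)–(BG5) for all composable arrows. -/
structure PreBraiding {Λ : Type u} {G : Type v} (L : LUAS Λ G) where
  rh : G → G → G   -- `x ⇀ y`, meaningful for composable pairs `t x = s y`
  lh : G → G → G   -- `x ↼ y`, meaningful for composable pairs `t x = s y`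
  s_rh : ∀ x y, L.t x = L.s y → L.s (rh x y) = L.s x
  t_rh : ∀ x y, L.t x = L.s y → L.t (rh x y) = L.s (lh x y)
  t_lh : ∀ x y, L.t x = L.s y → L.t (lh x y) = L.t y
  bg1 : ∀ x, (∃ u, L.t u = L.s x) →
    rh x (L.one (L.t x)) = L.one (L.s x) ∧ lh x (L.one (L.t x)) = x
  bg2 : ∀ x, (∃ u, L.t u = L.s x) →
    rh (L.one (L.s x)) x = x ∧ lh (L.one (L.s x)) x = L.one (L.t x)
  bg3 : ∀ x y z, L.t x = L.s y → L.t y = L.s z →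
    rh x (L.mul y z) = L.mul (rh x y) (rh (lh x y) z) ∧
    lh x (L.mul y z) = lh (lh x y) z
  bg4 : ∀ x y z, L.t x = L.s y → L.t y = L.s z →
    rh (L.mul x y) z = rh x (rh y z) ∧
    lh (L.mul x y) z = L.mul (lh x (rh y z)) (lh y z)
  bg5 : ∀ x y, L.t x = L.s y → L.mul (rh x y) (lh x y) = L.mul x y

/-- A pre-braiding on a left unital associative semiloopoid over a
nonempty set `Λ` satisfies the quiver-theoretic Yang–Baxter equation
`(σ⊗id)(id⊗σ)(σ⊗id) = (id⊗σ)(σ⊗id)(id⊗σ)` on composable triples of arrows,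
stated componentwise. -/
theorem preBraiding_yang_baxter {Λ : Type u} {G : Type v} [Nonempty Λ]
    (L : LUAS Λ G) (σ : PreBraiding L) (x y z : G)
    (hxy : L.t x = L.s y) (hyz : L.t y = L.s z) :
    σ.rh (σ.rh x y) (σ.rh (σ.lh x y) z) = σ.rh x (σ.rh y z) ∧
    σ.lh (σ.rh x y) (σ.rh (σ.lh x y) z) = σ.rh (σ.lh x (σ.rh y z)) (σ.lh y z) ∧
    σ.lh (σ.lh x y) z = σ.lh (σ.lh x (σ.rh y z)) (σ.lh y z) := by
  have hxy' := σ.t_rh x y hxy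
  have hlz : L.t (σ.lh x y) = L.s z := (σ.t_lh x y hxy).trans hyz
  have hyz' := σ.t_rh y z hyz
  have hxr : L.t x = L.s (σ.rh y z) := hxy.trans (σ.s_rh y z hyz).symm
  have hlr : L.t (σ.lh x (σ.rh y z)) = L.s (σ.lh y z) := (σ.t_lh x _ hxr).trans hyz'
  have hrr : L.t (σ.rh x y) = L.s (σ.rh (σ.lh x y) z) :=
    hxy'.trans (σ.s_rh _ _ hlz).symm
  have first : σ.rh (σ.rh x y) (σ.rh (σ.lh x y) z) = σ.rh x (σ.rh y z) := by
    rw [← (σ.bg4 _ _ z hxy' hlz).1, σ.bg5 x y hxy, (σ.bg4 x y z hxy hyz).1]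
  refine ⟨first, ?_, ?_⟩
  · have hmul : L.mul (σ.rh x (σ.rh y z)) (σ.lh (σ.rh x y) (σ.rh (σ.lh x y) z)) =
        L.mul (σ.rh x (σ.rh y z)) (σ.rh (σ.lh x (σ.rh y z)) (σ.lh y z)) := by
      rw [← (σ.bg3 x _ _ hxr hyz').1, σ.bg5 y z hyz, (σ.bg3 x y z hxy hyz).1, ← first,
        σ.bg5 _ _ hrr]
    have hleft : L.t (σ.rh x (σ.rh y z)) = L.s (σ.lh (σ.rh x y) (σ.rh (σ.lh x y) z)) :=
      first ▸ σ.t_rh _ _ hrr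
    have hright : L.t (σ.rh x (σ.rh y z)) =
        L.s (σ.rh (σ.lh x (σ.rh y z)) (σ.lh y z)) :=
      (σ.t_rh x _ hxr).trans (σ.s_rh _ _ hlr).symm
    rw [← L.ldiv_mul _ _ hleft, hmul, L.ldiv_mul _ _ hright]
  · rw [← (σ.bg3 x y z hxy hyz).2, ← σ.bg5 y z hyz, (σ.bg3 x _ _ hxr hyz').2]
end

section
/- Let G be the groupoid of pairs over a nonempty set Λ. Then: (1) every map σ : G⊗G → G⊗G preserving sources and targets (i.e., writing σ(x⊗y) = (x⇀y)⊗(x↼y), with s(x⇀y)=s(x), t(x⇀y)=s(x↼y), t(x↼y)=t(y)) is of the form σ([a,b]⊗[b,c]) = [a,⟨a,b,c⟩]⊗[⟨a,b,c⟩,c] for a unique ternary operation ⟨−,−,−⟩ on Λ; (2) such σ is a braiding on the groupoid (G,•) if and only if ⟨−,−,−⟩ is a heap operation on Λ; (3) under this correspondence, σ is involutive (σ∘σ = id) if and only if the heap is abelian. -/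
/-- Composable pairs of arrows of the groupoid of pairs over `Λ`:
an arrow `[a,b]` is the pair `(a,b)`, with source `a` and target `b`. -/
abbrev PComp (Λ : Type u) := {p : (Λ × Λ) × (Λ × Λ) // p.1.2 = p.2.1}

/-- The multiplication of the groupoid of pairs: `[a,b] • [b,c] = [a,c]`
(meaningful on composable pairs). -/
def pmul {Λ : Type u} (x y : Λ × Λ) : Λ × Λ := (x.1, y.2)

/-- The map `σ_T` on composable pairs associated with a ternary operation `T`:
`σ_T([a,b] ⊗ [b,c]) = [a, T a b c] ⊗ [T a b c, c]`. -/
def sigmaT {Λ : Type u} (T : Λ → Λ → Λ → Λ) (p : PComp Λ) : PComp Λ :=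
  ⟨((p.val.1.1, T p.val.1.1 p.val.1.2 p.val.2.2),
    (T p.val.1.1 p.val.1.2 p.val.2.2, p.val.2.2)), rfl⟩

/-- The first component `x ⇀ y` of `σ_T` (meaningful on composable pairs). -/
def rhT {Λ : Type u} (T : Λ → Λ → Λ → Λ) (x y : Λ × Λ) : Λ × Λ :=
  (x.1, T x.1 x.2 y.2)

/-- The second component `x ↼ y` of `σ_T` (meaningful on composable pairs). -/
def lhT {Λ : Type u} (T : Λ → Λ → Λ → Λ) (x y : Λ × Λ) : Λ × Λ :=
  (T x.1 x.2 y.2, y.2)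

/-- `σ_T` is a braiding on the groupoid of pairs: it is bijective and satisfies
(BG1)–(BG5) (units `1_a = [a,a]`, multiplication `pmul`) on composable arrows. -/
def IsPairBraiding {Λ : Type u} (T : Λ → Λ → Λ → Λ) : Prop :=
  Function.Bijective (sigmaT T) ∧
  (∀ x : Λ × Λ, rhT T x (x.2, x.2) = (x.1, x.1) ∧ lhT T x (x.2, x.2) = x) ∧
  (∀ x : Λ × Λ, rhT T (x.1, x.1) x = x ∧ lhT T (x.1, x.1) x = (x.2, x.2)) ∧
  (∀ x y z : Λ × Λ, x.2 = y.1 → y.2 = z.1 →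
    rhT T x (pmul y z) = pmul (rhT T x y) (rhT T (lhT T x y) z) ∧
    lhT T x (pmul y z) = lhT T (lhT T x y) z) ∧
  (∀ x y z : Λ × Λ, x.2 = y.1 → y.2 = z.1 →
    rhT T (pmul x y) z = rhT T x (rhT T y z) ∧
    lhT T (pmul x y) z = pmul (lhT T x (rhT T y z)) (lhT T y z)) ∧
  (∀ x y : Λ × Λ, x.2 = y.1 → pmul (rhT T x y) (lhT T x y) = pmul x y)

/-- `T` is a heap operation: (M1), (M2) and associativity (A). -/
def IsHeap {Λ : Type u} (T : Λ → Λ → Λ → Λ) : Prop :=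
  (∀ a b, T a b b = a) ∧ (∀ a b, T a a b = b) ∧
  (∀ a b c d e, T a b (T c d e) = T (T a b c) d e)

/-- In a heap, `b` is recovered from `T a b c` as `T c (T a b c) a`. -/
theorem IsHeap.apply_apply_swap {Λ : Type u} {T : Λ → Λ → Λ → Λ} (h : IsHeap T) (a b c : Λ) :
    T c (T a b c) a = b := by
  obtain ⟨h1, h2, hA⟩ := h
  have hc : T b a (T a b c) = c := by rw [hA, h1, h2]
  calc T c (T a b c) a = T (T b a (T a b c)) (T a b c) a := by rw [hc]
    _ = b := by rw [← hA, h2, h1]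

theorem IsHeap.bijective_sigmaT {Λ : Type u} {T : Λ → Λ → Λ → Λ} (h : IsHeap T) :
    Function.Bijective (sigmaT T) := by
  refine Function.bijective_iff_has_inverse.2 ⟨sigmaT fun a b c => T c b a, ?_, ?_⟩
  all_goals
    rintro ⟨⟨⟨a, b⟩, ⟨b', c⟩⟩, hb⟩
    obtain rfl : b = b' := hb
    simp [sigmaT, h.apply_apply_swap]

theorem IsPairBraiding.isHeap {Λ : Type u} {T : Λ → Λ → Λ → Λ} (h : IsPairBraiding T) :
    IsHeap T := by
  obtain ⟨-, h1, h2, h3, h4, -⟩ := h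
  have hr (a b c d) : T a b d = T (T a b c) c d :=
    congrArg Prod.snd (h3 (a, b) (b, c) (c, d) rfl rfl).1
  have hl (a b c d) : T a c d = T a b (T b c d) :=
    congrArg Prod.snd (h4 (a, b) (b, c) (c, d) rfl rfl).1
  refine ⟨fun a b => congrArg Prod.snd (h1 (a, b)).1,
    fun a b => congrArg Prod.snd (h2 (a, b)).1, fun a b c d e => ?_⟩
  rw [hr a b c, ← hl]

theorem IsHeap.isPairBraiding {Λ : Type u} {T : Λ → Λ → Λ → Λ} (h : IsHeap T) :
    IsPairBraiding T := by
  have hbij := h.bijective_sigmaT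
  obtain ⟨h1, h2, hA⟩ := h
  refine ⟨hbij, ?_, ?_, ?_, ?_, fun _ _ _ => rfl⟩
  · rintro ⟨a, b⟩
    simp [rhT, lhT, h1]
  · rintro ⟨a, b⟩
    simp [rhT, lhT, h2]
  · rintro ⟨a, b⟩ ⟨_, c⟩ ⟨_, d⟩ rfl rfl
    simp [rhT, lhT, pmul, ← hA, h2]
  · rintro ⟨a, b⟩ ⟨_, c⟩ ⟨_, d⟩ rfl rfl
    simp [rhT, lhT, pmul, hA, h1]

theorem existsUnique_eq_sigmaT {Λ : Type u} (σ : PComp Λ → PComp Λ)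
    (hσ : ∀ p, (σ p).val.1.1 = p.val.1.1 ∧ (σ p).val.2.2 = p.val.2.2) :
    ∃! T : Λ → Λ → Λ → Λ, σ = sigmaT T := by
  refine ⟨fun a b c => (σ ⟨((a, b), (b, c)), rfl⟩).val.1.2, ?_, ?_⟩
  · funext ⟨⟨⟨a, b⟩, ⟨b', c⟩⟩, hb⟩
    obtain rfl : b = b' := hb
    obtain ⟨hs, ht⟩ := hσ ⟨((a, b), (b, c)), rfl⟩
    exact Subtype.ext (Prod.ext (Prod.ext hs rfl) (Prod.ext (σ _).property.symm ht))
  · rintro T rfl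
    rfl

theorem IsHeap.sigmaT_comp_self_eq_id_iff {Λ : Type u} {T : Λ → Λ → Λ → Λ} (h : IsHeap T) :
    sigmaT T ∘ sigmaT T = id ↔ ∀ a b c : Λ, T a b c = T c b a := by
  constructor
  · intro hinv a b c
    have hT : T a (T a (T c b a) c) c = T c b a :=
      congrArg (fun p : PComp Λ => p.val.1.2)
        (congrFun hinv ⟨((a, T c b a), (T c b a, c)), rfl⟩)
    rwa [h.apply_apply_swap] at hT
  · intro hab
    funext ⟨⟨⟨a, b⟩, ⟨b', c⟩⟩, hb⟩
    obtain rfl : b = b' := hb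
    have hT : T a (T a b c) c = b := by rw [hab, h.apply_apply_swap]
    simp [sigmaT, hT]

/-- For the groupoid of pairs over a nonempty set `Λ`:
(1) every source- and target-preserving map `σ` on composable pairs comes from a
unique ternary operation `T` via `σ([a,b]⊗[b,c]) = [a,T a b c]⊗[T a b c,c]`;
(2) `σ_T` is a braiding on the groupoid of pairs iff `T` is a heap operation;
(3) for a heap `T`, `σ_T` is involutive iff the heap is abelian. -/
theorem pairGroupoid_braidings_are_heaps {Λ : Type u} [Nonempty Λ] :
    (∀ σ : PComp Λ → PComp Λ,
      (∀ p, (σ p).val.1.1 = p.val.1.1 ∧ (σ p).val.2.2 = p.val.2.2) →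
      ∃! T : Λ → Λ → Λ → Λ, σ = sigmaT T) ∧
    (∀ T : Λ → Λ → Λ → Λ, IsPairBraiding T ↔ IsHeap T) ∧
    (∀ T : Λ → Λ → Λ → Λ, IsHeap T →
      (sigmaT T ∘ sigmaT T = id ↔ ∀ a b c : Λ, T a b c = T c b a)) :=
  ⟨existsUnique_eq_sigmaT, fun _ => ⟨IsPairBraiding.isHeap, IsHeap.isPairBraiding⟩,
    fun _ h => h.sigmaT_comp_self_eq_id_iff⟩
end

section
/- Let (G,•) be a left unital associative semiloopoid over Λ and, for each λ ∈ Λ, let ·_λ be a group operation on G(λ,Λ). For composable x⊗y define x⇀y := x^{-1} ·_{s(x)} (x•y), where x^{-1} is the inverse of x in (G(s(x),Λ), ·_{s(x)}). Then the following are equivalent: (i) (G, {·_λ}, •) is a quiver-theoretic skew brace; (ii) (x•y)⇀z = x⇀(y⇀z) for all composable triples x⊗y⊗z; (iii) x⇀(y ·_{t(x)} z) = (x⇀y) ·_{s(x)} (x⇀z) whenever t(x) = s(y) = s(z). -/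
/-- A family of group operations `·_λ` on the sets `G(λ,Λ)` of arrows with source `λ`,
encoded by total operations meaningful on arrows with equal sources: `vmul x y` is
`x ·_{s x} y` (for `s y = s x`), `vinv x` is the inverse of `x` in `(G(s x,Λ), ·_{s x})`,
and `vone l` is the unit of `(G(l,Λ), ·_l)`. -/
structure VGroups {Λ : Type u} {G : Type v} (L : LUAS Λ G) where
  vmul : G → G → G
  vinv : G → G
  vone : Λ → G
  s_vmul : ∀ x y, L.s y = L.s x → L.s (vmul x y) = L.s x
  s_vinv : ∀ x, L.s (vinv x) = L.s x
  s_vone : ∀ l, L.s (vone l) = l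
  vassoc : ∀ x y z, L.s y = L.s x → L.s z = L.s x →
    vmul (vmul x y) z = vmul x (vmul y z)
  vone_mul : ∀ x, vmul (vone (L.s x)) x = x
  vmul_one : ∀ x, vmul x (vone (L.s x)) = x
  vinv_mul : ∀ x, vmul (vinv x) x = vone (L.s x)
  vmul_inv : ∀ x, vmul x (vinv x) = vone (L.s x)

/-- The bracoid compatibility: `x • (y ·_{t x} z) = (x•y) ·_{s x} x⁻¹ ·_{s x} (x•z)`
for all `x, y, z` with `t x = s y = s z`; a left unital associative semiloopoid with
vertex groups satisfying it is a quiver-theoretic skew brace. -/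
def IsQTSB {Λ : Type u} {G : Type v} (L : LUAS Λ G) (V : VGroups L) : Prop :=
  ∀ x y z, L.t x = L.s y → L.s z = L.s y →
    L.mul x (V.vmul y z) = V.vmul (L.mul x y) (V.vmul (V.vinv x) (L.mul x z))

/-- The map `x ⇀ y := x⁻¹ ·_{s x} (x • y)` (meaningful for composable pairs). -/
def rha {Λ : Type u} {G : Type v} (L : LUAS Λ G) (V : VGroups L) (x y : G) : G :=
  V.vmul (V.vinv x) (L.mul x y)

namespace VGroups

variable {Λ : Type*} {G : Type*} {L : LUAS Λ G} (V : VGroups L)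

theorem vinv_vmul_cancel_left {a b : G} (h : L.s b = L.s a) :
    V.vmul (V.vinv a) (V.vmul a b) = b := by
  rw [← V.vassoc _ _ _ (V.s_vinv a).symm (h.trans (V.s_vinv a).symm), V.vinv_mul, ← h,
    V.vone_mul]

theorem vmul_vinv_cancel_left {a b : G} (h : L.s b = L.s a) :
    V.vmul a (V.vmul (V.vinv a) b) = b := by
  rw [← V.vassoc _ _ _ (V.s_vinv a) h, V.vmul_inv, ← h, V.vone_mul]

theorem vmul_left_cancel {a b c : G} (hb : L.s b = L.s a) (hc : L.s c = L.s a)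
    (h : V.vmul a b = V.vmul a c) : b = c := by
  rw [← V.vinv_vmul_cancel_left hb, h, V.vinv_vmul_cancel_left hc]

theorem s_rha {x y : G} (h : L.t x = L.s y) : L.s (rha L V x y) = L.s x := by
  rw [rha, V.s_vmul _ _ ((L.s_mul x y h).trans (V.s_vinv x).symm), V.s_vinv]

theorem vmul_rha {x y : G} (h : L.t x = L.s y) : V.vmul x (rha L V x y) = L.mul x y :=
  V.vmul_vinv_cancel_left (L.s_mul x y h)

/-- The cocycle identity `(x ⇀ y) · ((x • y) ⇀ z) = x ⇀ (y • z)`, valid without any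
compatibility assumption. -/
theorem rha_vmul_rha_mul {x y z : G} (hxy : L.t x = L.s y) (hyz : L.t y = L.s z) :
    V.vmul (rha L V x y) (rha L V (L.mul x y) z) = rha L V x (L.mul y z) := by
  have hxyz : L.t (L.mul x y) = L.s z := (L.t_mul x y hxy).trans hyz
  have hx : L.t x = L.s (L.mul y z) := hxy.trans (L.s_mul y z hyz).symm
  have hs : L.s (rha L V (L.mul x y) z) = L.s x := (V.s_rha hxyz).trans (L.s_mul x y hxy)
  have hs' : L.s (rha L V x y) = L.s x := V.s_rha hxy
  apply V.vmul_left_cancel ((V.s_vmul _ _ (hs.trans hs'.symm)).trans hs') (V.s_rha hx)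
  rw [← V.vassoc _ _ _ hs' hs, V.vmul_rha hxy, V.vmul_rha hxyz, V.vmul_rha hx,
    L.massoc x y z hxy hyz]

theorem isQTSB_iff_rha_vmul :
    IsQTSB L V ↔
      ∀ x y z, L.t x = L.s y → L.t x = L.s z →
        rha L V x (V.vmul y z) = V.vmul (rha L V x y) (rha L V x z) := by
  have key {x y z : G} (hy : L.t x = L.s y) (hz : L.t x = L.s z) :
      V.vmul x (V.vmul (rha L V x y) (rha L V x z)) =
        V.vmul (L.mul x y) (V.vmul (V.vinv x) (L.mul x z)) := by
    rw [← V.vassoc _ _ _ (V.s_rha hy) (V.s_rha hz), V.vmul_rha hy, rha]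
  have hmul {x y z : G} (hy : L.t x = L.s y) (hz : L.t x = L.s z) :
      L.t x = L.s (V.vmul y z) := hy.trans (V.s_vmul y z (hz.symm.trans hy)).symm
  constructor
  · intro h x y z hy hz
    have hs : L.s (rha L V x y) = L.s x := V.s_rha hy
    apply V.vmul_left_cancel (V.s_rha (hmul hy hz))
      ((V.s_vmul _ _ ((V.s_rha hz).trans hs.symm)).trans hs)
    rw [V.vmul_rha (hmul hy hz), key hy hz, h x y z hy (hz.symm.trans hy)]
  · intro h x y z hy hzy
    have hz : L.t x = L.s z := hy.trans hzy.symm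
    rw [← V.vmul_rha (hmul hy hz), h x y z hy hz, key hy hz]

theorem rha_mul_iff_rha_vmul :
    (∀ x y z, L.t x = L.s y → L.t y = L.s z →
        rha L V (L.mul x y) z = rha L V x (rha L V y z)) ↔
      ∀ x y z, L.t x = L.s y → L.t x = L.s z →
        rha L V x (V.vmul y z) = V.vmul (rha L V x y) (rha L V x z) := by
  constructor
  · intro h x y u hy hu
    have huy : L.s u = L.s y := hu.symm.trans hy
    have hs : L.s (V.vmul y u) = L.s y := V.s_vmul y u huy
    have hz : L.t y = L.s (L.ldiv y (V.vmul y u)) := (L.s_ldiv _ _ hs).symm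
    have hrha : rha L V y (L.ldiv y (V.vmul y u)) = u := by
      rw [rha, L.mul_ldiv _ _ hs, V.vinv_vmul_cancel_left huy]
    have hcocycle := V.rha_vmul_rha_mul hy hz
    rw [h x y _ hy hz, hrha, L.mul_ldiv _ _ hs] at hcocycle
    exact hcocycle.symm
  · intro h x y z hy hz
    have hxyz : L.t (L.mul x y) = L.s z := (L.t_mul x y hy).trans hz
    have hx : L.t x = L.s (rha L V y z) := hy.trans (V.s_rha hz).symm
    have hs : L.s (rha L V x y) = L.s x := V.s_rha hy
    apply V.vmul_left_cancel (a := rha L V x y)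
      ((V.s_rha hxyz).trans ((L.s_mul x y hy).trans hs.symm)) ((V.s_rha hx).trans hs.symm)
    rw [V.rha_vmul_rha_mul hy hz, ← h x y _ hy hx, V.vmul_rha hz]

end VGroups

/-- Let `(G,•)` be a left unital associative semiloopoid over `Λ` with
group operations `·_λ` on each `G(λ,Λ)`, and set `x ⇀ y := x⁻¹ ·_{s x} (x•y)`. The
following are equivalent: (i) `(G, {·_λ}, •)` is a quiver-theoretic skew brace;
(ii) `(x•y) ⇀ z = x ⇀ (y ⇀ z)` for all composable triples; (iii)
`x ⇀ (y ·_{t x} z) = (x ⇀ y) ·_{s x} (x ⇀ z)` whenever `t x = s y = s z`. -/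
theorem qtsb_iff_rh_action_iff_rh_hom {Λ : Type u} {G : Type v} [Nonempty Λ]
    (L : LUAS Λ G) (V : VGroups L) :
    (IsQTSB L V ↔
      ∀ x y z, L.t x = L.s y → L.t y = L.s z →
        rha L V (L.mul x y) z = rha L V x (rha L V y z)) ∧
    (IsQTSB L V ↔
      ∀ x y z, L.t x = L.s y → L.t x = L.s z →
        rha L V x (V.vmul y z) = V.vmul (rha L V x y) (rha L V x z)) :=
  ⟨V.isQTSB_iff_rha_vmul.trans V.rha_mul_iff_rha_vmul.symm, V.isQTSB_iff_rha_vmul⟩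
end

section
/- Let (G, {·_λ}, •) be a quiver-theoretic skew brace over Λ. For composable x⊗y define x⇀y := x^{-1} ·_{s(x)} (x•y) and x↼y := (x⇀y)\(x•y), where x^{-1} is the inverse in (G(s(x),Λ), ·_{s(x)}) and \ is the left division of •. Then σ(x⊗y) := (x⇀y)⊗(x↼y) is a braiding on G (a bijective pre-braiding) which is left non-degenerate, i.e., for every arrow x the map x⇀(−) : G(t(x),Λ) → G(s(x),Λ) is bijective. Moreover, σ is involutive (σ∘σ = id) if and only if all the groups (G(λ,Λ), ·_λ), λ ∈ Λ, are abelian. -/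
/-- The map `x ↼ y := (x ⇀ y) \ (x • y)` (meaningful for composable pairs), where
`\` is the left division of `•`. -/
def lha {Λ : Type u} {G : Type v} (L : LUAS Λ G) (V : VGroups L) (x y : G) : G :=
  L.ldiv (rha L V x y) (L.mul x y)

namespace LUAS

variable {Λ : Type u} {G : Type v} (L : LUAS Λ G)

theorem mul_left_cancel {x y z : G} (hy : L.t x = L.s y) (hz : L.t x = L.s z)
    (h : L.mul x y = L.mul x z) : y = z := by
  rw [← L.ldiv_mul x y hy, h, L.ldiv_mul x z hz]

theorem t_ldiv {x y : G} (h : L.s y = L.s x) : L.t (L.ldiv x y) = L.t y := by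
  rw [← L.t_mul x _ (L.s_ldiv x y h).symm, L.mul_ldiv x y h]

end LUAS

namespace VGroups

variable {Λ : Type u} {G : Type v} {L : LUAS Λ G} (V : VGroups L)

theorem vinv_mul_cancel_left {x y : G} (h : L.s y = L.s x) :
    V.vmul (V.vinv x) (V.vmul x y) = y := by
  have hx := V.s_vinv x
  rw [← V.vassoc _ _ _ hx.symm (h.trans hx.symm), V.vinv_mul, ← h, V.vone_mul]

theorem vmul_inv_cancel_left {x y : G} (h : L.s y = L.s x) :
    V.vmul x (V.vmul (V.vinv x) y) = y := by
  rw [← V.vassoc _ _ _ (V.s_vinv x) h, V.vmul_inv, ← h, V.vone_mul]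

theorem vmul_inv_cancel_right {x y : G} (h : L.s y = L.s x) :
    V.vmul (V.vmul x y) (V.vinv y) = x := by
  rw [V.vassoc _ _ _ h ((V.s_vinv y).trans h), V.vmul_inv, h, V.vmul_one]

theorem vinv_mul_cancel_right {x y : G} (h : L.s y = L.s x) :
    V.vmul (V.vmul x (V.vinv y)) y = x := by
  rw [V.vassoc _ _ _ ((V.s_vinv y).trans h) h, V.vinv_mul, h, V.vmul_one]

theorem vmul_left_cancel_s5 {x y z : G} (hy : L.s y = L.s x) (hz : L.s z = L.s x)
    (h : V.vmul x y = V.vmul x z) : y = z := by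
  rw [← V.vinv_mul_cancel_left hy, h, V.vinv_mul_cancel_left hz]

theorem vmul_right_cancel {x y z : G} (hx : L.s z = L.s x) (hy : L.s z = L.s y)
    (h : V.vmul x z = V.vmul y z) : x = y := by
  rw [← V.vmul_inv_cancel_right hx, h, V.vmul_inv_cancel_right hy]

end VGroups

section Actions

variable {Λ : Type u} {G : Type v} (L : LUAS Λ G) (V : VGroups L)

theorem s_rha {x y : G} (h : L.t x = L.s y) : L.s (rha L V x y) = L.s x := by
  unfold rha
  rw [V.s_vmul _ _ ((L.s_mul x y h).trans (V.s_vinv x).symm), V.s_vinv]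

theorem vmul_rha {x y : G} (h : L.t x = L.s y) :
    V.vmul x (rha L V x y) = L.mul x y :=
  V.vmul_inv_cancel_left (L.s_mul x y h)

theorem rha_eq_of_vmul_eq {x y w : G} (h : L.t x = L.s y) (hw : L.s w = L.s x)
    (e : V.vmul x w = L.mul x y) : rha L V x y = w :=
  V.vmul_left_cancel_s5 (s_rha L V h) hw ((vmul_rha L V h).trans e.symm)

theorem s_mul_eq_s_rha {x y : G} (h : L.t x = L.s y) :
    L.s (L.mul x y) = L.s (rha L V x y) :=
  (L.s_mul x y h).trans (s_rha L V h).symm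

theorem s_lha {x y : G} (h : L.t x = L.s y) :
    L.s (lha L V x y) = L.t (rha L V x y) :=
  L.s_ldiv _ _ (s_mul_eq_s_rha L V h)

theorem t_lha {x y : G} (h : L.t x = L.s y) : L.t (lha L V x y) = L.t y :=
  (L.t_ldiv (s_mul_eq_s_rha L V h)).trans (L.t_mul x y h)

theorem rha_mul_lha {x y : G} (h : L.t x = L.s y) :
    L.mul (rha L V x y) (lha L V x y) = L.mul x y :=
  L.mul_ldiv _ _ (s_mul_eq_s_rha L V h)

theorem lha_eq_of_mul_eq {x y w : G} (h : L.t x = L.s y)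
    (hw : L.t (rha L V x y) = L.s w) (e : L.mul (rha L V x y) w = L.mul x y) :
    lha L V x y = w :=
  L.mul_left_cancel (s_lha L V h).symm hw ((rha_mul_lha L V h).trans e.symm)

theorem rha_injective {x y z : G} (hy : L.t x = L.s y) (hz : L.t x = L.s z)
    (h : rha L V x y = rha L V x z) : y = z :=
  L.mul_left_cancel hy hz (by rw [← vmul_rha L V hy, h, vmul_rha L V hz])

theorem exists_rha_eq {x w : G} (h : L.s w = L.s x) :
    ∃ y, L.t x = L.s y ∧ rha L V x y = w := by
  have hs := V.s_vmul x w h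
  have hy := (L.s_ldiv x _ hs).symm
  exact ⟨_, hy, rha_eq_of_vmul_eq L V hy h (L.mul_ldiv x _ hs).symm⟩

/-- The map `σ` is bijective on composable pairs. -/
theorem existsUnique_rha_lha {p q : G} (h : L.t p = L.s q) :
    ∃! w : G × G, L.t w.1 = L.s w.2 ∧ rha L V w.1 w.2 = p ∧ lha L V w.1 w.2 = q := by
  have hpq := L.s_mul p q h
  have hx : L.s (V.vmul (L.mul p q) (V.vinv p)) = L.s p :=
    (V.s_vmul _ _ ((V.s_vinv p).trans hpq.symm)).trans hpq
  have hxp := V.vinv_mul_cancel_right hpq.symm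
  generalize V.vmul (L.mul p q) (V.vinv p) = x at hx hxp
  have hs : L.s (L.mul p q) = L.s x := hpq.trans hx.symm
  have hy := (L.s_ldiv x _ hs).symm
  have hm := L.mul_ldiv x _ hs
  have hr : rha L V x (L.ldiv x (L.mul p q)) = p :=
    rha_eq_of_vmul_eq L V hy hx.symm (hxp.trans hm.symm)
  refine ⟨(x, L.ldiv x (L.mul p q)), ⟨hy, hr, ?_⟩, ?_⟩
  · exact lha_eq_of_mul_eq L V hy (by rw [hr, h]) (by rw [hr, hm])
  · rintro ⟨a, b⟩ ⟨hab, ha, hb⟩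
    dsimp only at hab ha hb
    have hsa := s_rha L V hab
    have e := vmul_rha L V hab
    have e' := rha_mul_lha L V hab
    rw [ha, hb] at e'
    rw [ha] at hsa e
    have hax : a = x :=
      V.vmul_right_cancel hsa hx.symm (by rw [e, hxp, e'])
    subst hax
    rw [e', L.ldiv_mul _ _ hab]

theorem involutive_iff_abelian :
    (∀ x y, L.t x = L.s y →
        rha L V (rha L V x y) (lha L V x y) = x ∧
        lha L V (rha L V x y) (lha L V x y) = y) ↔
      (∀ x y, L.s y = L.s x → V.vmul x y = V.vmul y x) := by
  constructor
  · intro H x z h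
    obtain ⟨y, hy, rfl⟩ := exists_rha_eq L V h
    have e := vmul_rha L V (s_lha L V hy).symm
    rw [(H x y hy).1, rha_mul_lha L V hy] at e
    rw [e, vmul_rha L V hy]
  · intro H x y h
    have hs := s_rha L V h
    have hc := (s_lha L V h).symm
    have hr : rha L V (rha L V x y) (lha L V x y) = x :=
      rha_eq_of_vmul_eq L V hc hs.symm
        (by rw [rha_mul_lha L V h, ← H _ _ hs, vmul_rha L V h])
    exact ⟨hr, lha_eq_of_mul_eq L V hc (by rw [hr, h]) (by rw [hr, rha_mul_lha L V h])⟩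

end Actions

namespace IsQTSB

variable {Λ : Type u} {G : Type v} {L : LUAS Λ G} {V : VGroups L}

/-- The units of the semiloopoid are the units of the vertex groups. -/
theorem one_eq_vone (hB : IsQTSB L V) {l : Λ} (hl : ∃ x, L.t x = l) : L.one l = V.vone l := by
  have h1 := L.s_one l hl
  obtain ⟨x, rfl⟩ := hl
  have e := hB x (L.one (L.t x)) (L.one (L.t x)) h1.symm rfl
  rw [L.mul_one, V.vmul_inv_cancel_left rfl] at e
  have hmul : V.vmul (L.one (L.t x)) (L.one (L.t x)) = L.one (L.t x) :=
    L.mul_left_cancel (by rw [V.s_vmul _ _ rfl, h1]) h1.symm (e.trans (L.mul_one x).symm)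
  have hv := V.vmul_one (L.one (L.t x))
  rw [h1] at hv
  exact V.vmul_left_cancel_s5 rfl ((V.s_vone _).trans h1.symm) (hmul.trans hv.symm)

theorem rha_mul_left (hB : IsQTSB L V) {x y z : G} (hxy : L.t x = L.s y) (hyz : L.t y = L.s z) :
    rha L V (L.mul x y) z = rha L V x (rha L V y z) := by
  have hs := s_rha L V hyz
  have hc : L.t x = L.s (rha L V y z) := hxy.trans hs.symm
  refine rha_eq_of_vmul_eq L V ((L.t_mul x y hxy).trans hyz)
    ((s_rha L V hc).trans (L.s_mul x y hxy).symm) ?_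
  rw [L.massoc x y z hxy hyz, ← vmul_rha L V hyz]
  exact (hB x y _ hxy hs).symm

theorem lha_mul_left (hB : IsQTSB L V) {x y z : G} (hxy : L.t x = L.s y) (hyz : L.t y = L.s z) :
    lha L V (L.mul x y) z = L.mul (lha L V x (rha L V y z)) (lha L V y z) := by
  have hc : L.t x = L.s (rha L V y z) := hxy.trans (s_rha L V hyz).symm
  have ht : L.t (lha L V x (rha L V y z)) = L.s (lha L V y z) :=
    (t_lha L V hc).trans (s_lha L V hyz).symm
  have hs := s_lha L V hc
  refine lha_eq_of_mul_eq L V ((L.t_mul x y hxy).trans hyz) ?_ ?_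
  · rw [hB.rha_mul_left hxy hyz, L.s_mul _ _ ht, hs]
  · rw [hB.rha_mul_left hxy hyz, ← L.massoc _ _ _ hs.symm ht, rha_mul_lha L V hc,
      L.massoc _ _ _ hc (s_lha L V hyz).symm, rha_mul_lha L V hyz, L.massoc x y z hxy hyz]

theorem rha_mul_right (hB : IsQTSB L V) {x y z : G} (hxy : L.t x = L.s y) (hyz : L.t y = L.s z) :
    rha L V x (L.mul y z) = L.mul (rha L V x y) (rha L V (lha L V x y) z) := by
  have hab := (s_lha L V hxy).symm
  have hbz : L.t (lha L V x y) = L.s z := (t_lha L V hxy).trans hyz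
  have hc := hab.trans (s_rha L V hbz).symm
  have hm : L.t (L.mul x y) = L.s z := (L.t_mul x y hxy).trans hyz
  have hs := s_rha L V hxy
  have hsm := (s_rha L V hm).trans (L.s_mul x y hxy)
  refine rha_eq_of_vmul_eq L V (hxy.trans (L.s_mul y z hyz).symm)
    ((L.s_mul _ _ hc).trans hs) ?_
  rw [← vmul_rha L V hc, ← hB.rha_mul_left hab hbz, rha_mul_lha L V hxy,
    ← V.vassoc _ _ _ hs hsm, vmul_rha L V hxy, vmul_rha L V hm, L.massoc x y z hxy hyz]

theorem lha_mul_right (hB : IsQTSB L V) {x y z : G} (hxy : L.t x = L.s y) (hyz : L.t y = L.s z) :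
    lha L V x (L.mul y z) = lha L V (lha L V x y) z := by
  have hab := (s_lha L V hxy).symm
  have hbz : L.t (lha L V x y) = L.s z := (t_lha L V hxy).trans hyz
  have hc := hab.trans (s_rha L V hbz).symm
  have hd := (s_lha L V hbz).symm
  refine lha_eq_of_mul_eq L V (hxy.trans (L.s_mul y z hyz).symm) ?_ ?_
  · rw [hB.rha_mul_right hxy hyz, L.t_mul _ _ hc, hd]
  · rw [hB.rha_mul_right hxy hyz, L.massoc _ _ _ hc hd, rha_mul_lha L V hbz,
      ← L.massoc _ _ _ hab hbz, rha_mul_lha L V hxy, L.massoc x y z hxy hyz]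

theorem rha_one (hB : IsQTSB L V) {x : G} (hx : ∃ u, L.t u = L.s x) :
    rha L V x (L.one (L.t x)) = L.one (L.s x) := by
  refine rha_eq_of_vmul_eq L V (L.s_one _ ⟨x, rfl⟩).symm (L.s_one _ hx) ?_
  rw [hB.one_eq_vone hx, V.vmul_one, L.mul_one]

theorem lha_one (hB : IsQTSB L V) {x : G} (hx : ∃ u, L.t u = L.s x) :
    lha L V x (L.one (L.t x)) = x := by
  have hr := hB.rha_one hx
  refine lha_eq_of_mul_eq L V (L.s_one _ ⟨x, rfl⟩).symm ?_ ?_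
  · rw [hr, L.t_one _ hx]
  · rw [hr, L.one_mul x hx, L.mul_one]

theorem one_rha (hB : IsQTSB L V) {x : G} (hx : ∃ u, L.t u = L.s x) :
    rha L V (L.one (L.s x)) x = x := by
  refine rha_eq_of_vmul_eq L V (L.t_one _ hx) (L.s_one _ hx).symm ?_
  rw [L.one_mul x hx, hB.one_eq_vone hx, V.vone_mul]

theorem one_lha (hB : IsQTSB L V) {x : G} (hx : ∃ u, L.t u = L.s x) :
    lha L V (L.one (L.s x)) x = L.one (L.t x) := by
  have hr := hB.one_rha hx
  refine lha_eq_of_mul_eq L V (L.t_one _ hx) ?_ ?_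
  · rw [hr, L.s_one _ ⟨x, rfl⟩]
  · rw [hr, L.one_mul x hx, L.mul_one]

end IsQTSB

/-- Let `(G, {·_λ}, •)` be a quiver-theoretic skew brace over `Λ` and
define `x ⇀ y := x⁻¹ ·_{s x} (x•y)`, `x ↼ y := (x ⇀ y) \ (x•y)`. Then
`σ(x⊗y) := (x⇀y)⊗(x↼y)` is a braiding on `G`: a morphism of quivers on composable
pairs satisfying (BG1)–(BG5), which is bijective; it is left non-degenerate, i.e.
every `x ⇀ (−) : G(t x,Λ) → G(s x,Λ)` is bijective; and it is involutive if and only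
if all the groups `(G(λ,Λ), ·_λ)` are abelian. -/
theorem qtsb_braiding {Λ : Type u} {G : Type v} [Nonempty Λ]
    (L : LUAS Λ G) (V : VGroups L) (hB : IsQTSB L V) :
    -- σ is a morphism of quivers on composable pairs
    (∀ x y, L.t x = L.s y →
      L.s (rha L V x y) = L.s x ∧ L.t (rha L V x y) = L.s (lha L V x y) ∧
      L.t (lha L V x y) = L.t y) ∧
    -- (BG1)
    (∀ x, (∃ u, L.t u = L.s x) →
      rha L V x (L.one (L.t x)) = L.one (L.s x) ∧ lha L V x (L.one (L.t x)) = x) ∧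
    -- (BG2)
    (∀ x, (∃ u, L.t u = L.s x) →
      rha L V (L.one (L.s x)) x = x ∧ lha L V (L.one (L.s x)) x = L.one (L.t x)) ∧
    -- (BG3)
    (∀ x y z, L.t x = L.s y → L.t y = L.s z →
      rha L V x (L.mul y z) = L.mul (rha L V x y) (rha L V (lha L V x y) z) ∧
      lha L V x (L.mul y z) = lha L V (lha L V x y) z) ∧
    -- (BG4)
    (∀ x y z, L.t x = L.s y → L.t y = L.s z →
      rha L V (L.mul x y) z = rha L V x (rha L V y z) ∧
      lha L V (L.mul x y) z = L.mul (lha L V x (rha L V y z)) (lha L V y z)) ∧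
    -- (BG5)
    (∀ x y, L.t x = L.s y → L.mul (rha L V x y) (lha L V x y) = L.mul x y) ∧
    -- σ is bijective on composable pairs
    (∀ p q : G, L.t p = L.s q →
      ∃! w : G × G, L.t w.1 = L.s w.2 ∧ rha L V w.1 w.2 = p ∧ lha L V w.1 w.2 = q) ∧
    -- left non-degeneracy
    (∀ x y y', L.t x = L.s y → L.t x = L.s y' → rha L V x y = rha L V x y' → y = y') ∧
    (∀ x w, L.s w = L.s x → ∃ y, L.t x = L.s y ∧ rha L V x y = w) ∧
    -- involutivity iff all vertex groups are abelian
    ((∀ x y, L.t x = L.s y →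
        rha L V (rha L V x y) (lha L V x y) = x ∧
        lha L V (rha L V x y) (lha L V x y) = y) ↔
      (∀ x y, L.s y = L.s x → V.vmul x y = V.vmul y x)) := by
  refine ⟨fun x y h => ⟨s_rha L V h, (s_lha L V h).symm, t_lha L V h⟩,
    fun x hx => ⟨hB.rha_one hx, hB.lha_one hx⟩,
    fun x hx => ⟨hB.one_rha hx, hB.one_lha hx⟩,
    fun x y z hxy hyz => ⟨hB.rha_mul_right hxy hyz, hB.lha_mul_right hxy hyz⟩,
    fun x y z hxy hyz => ⟨hB.rha_mul_left hxy hyz, hB.lha_mul_left hxy hyz⟩,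
    fun x y h => rha_mul_lha L V h,
    fun p q h => existsUnique_rha_lha L V h,
    fun x y y' hy hy' h => rha_injective L V hy hy' h,
    fun x w h => exists_rha_eq L V h,
    involutive_iff_abelian L V⟩
end

section
/- Let A be a group and S a nonempty family of regular subsets of Hol(A) such that α^{-1}S ∈ S for every S ∈ S and every α ∈ S (so that S, indexed by itself with transition φ(S,a) := (a,f^S_a)^{-1}S, is a regular dynamical subgroup of Hol(A) defining a dynamical skew brace on A). Let Q be the associated quiver (one arrow from S to (a,f^S_a)^{-1}S for each a ∈ A), let S_un := {S ∈ S : (1_A,id) ∈ S} and S_in := S∖S_un. Then: (i) if S ∈ S_un and S' ∈ Ss^0_A lies in the same connected component of the quiver of Ss^0_A as S, then S' ∈ S_un; (ii) for every S ∈ S_in and all S', S'' ∈ S_un lying in the same connected component of Q, there is a bijection between the set Q(S,S') of arrows from S to S' and the set Q(S',S'') of arrows from S' to S''; (iii) for every S ∈ S_in and all S', S'' ∈ S_un in the same connected component of Q, there is a bijection between Q(S,S') and Q(S,S''). -/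
/-- The holomorph `Hol(A) = A ⋊ Aut(A)`, with `Aut(A)` acting on `A` by evaluation;
elements are pairs `⟨a, f⟩` with multiplication `⟨a,f⟩⟨b,g⟩ = ⟨a·f(b), f∘g⟩`. -/
abbrev Hol (A : Type u) [Group A] :=
  SemidirectProduct A (MulAut A) (MonoidHom.id (MulAut A))

/-- A subset `S ⊆ Hol(A)` is regular if for every `a ∈ A` there is a unique
`f ∈ Aut(A)` with `(a, f) ∈ S`. -/
def IsRegularSubset {A : Type u} [Group A] (S : Set (Hol A)) : Prop :=
  ∀ a : A, ∃! f : MulAut A, (⟨a, f⟩ : Hol A) ∈ S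

/-- For a subset `S ⊆ Hol(A)` and a label `a ∈ A`, the translate
`(a, f^S_a)⁻¹ • S` (for `S` regular, `f^S_a` is the unique automorphism paired with
`a`); this is the target of the arrow with source `S` and label `a` in the quiver
associated with a family of regular subsets. -/
def trg {A : Type u} [Group A] (S : Set (Hol A)) (a : A) : Set (Hol A) :=
  {β : Hol A | ∃ f : MulAut A, (⟨a, f⟩ : Hol A) ∈ S ∧ (⟨a, f⟩ : Hol A) * β ∈ S}

/-- Adjacency in (the underlying undirected graph of) the quiver of `Ss⁰_A`, whose
vertices are the regular subsets of `Hol(A)` containing `(1_A, id)` and whose arrows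
go from `S` to `(a, f^S_a)⁻¹ S` for each `a ∈ A`. Connected components are given by
`Relation.EqvGen` of this relation. -/
def adj0 {A : Type u} [Group A] (S S' : Set (Hol A)) : Prop :=
  (IsRegularSubset S ∧ (⟨1, 1⟩ : Hol A) ∈ S) ∧
  (IsRegularSubset S' ∧ (⟨1, 1⟩ : Hol A) ∈ S') ∧
  ∃ a : A, trg S a = S'

/-- Adjacency in the quiver `Q` associated with a family `𝒮` of regular subsets of
`Hol(A)` closed under the translations: arrows go from `S ∈ 𝒮` to `trg S a`. -/
def adjF {A : Type u} [Group A] (F : Set (Set (Hol A)))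
    (S S' : Set (Hol A)) : Prop :=
  S ∈ F ∧ S' ∈ F ∧ ∃ a : A, trg S a = S'

open scoped Pointwise

lemma mem_trg_iff {A : Type u} [Group A] {S : Set (Hol A)} (hS : IsRegularSubset S)
    {α : Hol A} (hα : α ∈ S) (β : Hol A) : β ∈ trg S α.left ↔ α * β ∈ S := by
  constructor
  · rintro ⟨f, hf, hfβ⟩
    have h : f = α.right := (hS α.left).unique hf hα
    subst h
    exact hfβ
  · intro h
    exact ⟨α.right, hα, h⟩

lemma smul_trg {A : Type u} [Group A] {S : Set (Hol A)} (hS : IsRegularSubset S)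
    {α : Hol A} (hα : α ∈ S) : α • trg S α.left = S := by
  ext β
  rw [Set.mem_smul_set_iff_inv_smul_mem, mem_trg_iff hS hα, smul_eq_mul, mul_inv_cancel_left]

lemma exists_smul_trg {A : Type u} [Group A] {S : Set (Hol A)} (hS : IsRegularSubset S)
    (a : A) : ∃ α : Hol A, α.left = a ∧ α ∈ S ∧ α • trg S a = S := by
  obtain ⟨f, hf, -⟩ := hS a
  exact ⟨⟨a, f⟩, rfl, hf, smul_trg hS hf⟩

lemma mem_of_smul_eq {A : Type u} [Group A] {S T : Set (Hol A)} (hT : (1 : Hol A) ∈ T)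
    {α : Hol A} (h : α • T = S) : α ∈ S := by
  rw [← h]
  exact ⟨1, hT, mul_one α⟩

lemma trg_eq_of_smul_eq {A : Type u} [Group A] {S T : Set (Hol A)} (hS : IsRegularSubset S)
    (hT : (1 : Hol A) ∈ T) {α : Hol A} (h : α • T = S) : trg S α.left = T :=
  smul_left_cancel α ((smul_trg hS (mem_of_smul_eq hT h)).trans h.symm)

/-- Arrows from `S` to a vertex `T` containing the identity are the elements of the holomorph
carrying `T` to `S`. -/
noncomputable def arrowEquiv {A : Type u} [Group A] {S T : Set (Hol A)}
    (hS : IsRegularSubset S) (hT : (1 : Hol A) ∈ T) :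
    {α : Hol A // α • T = S} ≃ {a : A // trg S a = T} :=
  Equiv.ofBijective (fun α => ⟨α.1.left, trg_eq_of_smul_eq hS hT α.2⟩) <| by
    constructor
    · rintro ⟨α, hα⟩ ⟨β, hβ⟩ h
      have hl : α.left = β.left := congrArg Subtype.val h
      have hα' : (⟨β.left, α.right⟩ : Hol A) ∈ S := hl ▸ mem_of_smul_eq hT hα
      exact Subtype.ext (SemidirectProduct.ext hl
        ((hS β.left).unique hα' (mem_of_smul_eq hT hβ)))
    · rintro ⟨a, rfl⟩
      obtain ⟨α, rfl, -, h⟩ := exists_smul_trg hS a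
      exact ⟨⟨α, h⟩, rfl⟩

lemma exists_smul_eq_of_eqvGen {A : Type u} [Group A]
    {r : Set (Hol A) → Set (Hol A) → Prop}
    (hr : ∀ S T, r S T → IsRegularSubset S ∧ ∃ a, trg S a = T)
    {S T : Set (Hol A)} (h : Relation.EqvGen r S T) : ∃ α : Hol A, α • T = S := by
  induction h with
  | rel S T h =>
    obtain ⟨hS, a, rfl⟩ := hr S T h
    obtain ⟨α, -, -, h⟩ := exists_smul_trg hS a
    exact ⟨α, h⟩
  | refl S => exact ⟨1, one_smul _ S⟩
  | symm S T _ ih =>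
    obtain ⟨α, rfl⟩ := ih
    exact ⟨α⁻¹, inv_smul_smul α T⟩
  | trans S T U _ _ ih₁ ih₂ =>
    obtain ⟨α, rfl⟩ := ih₁
    obtain ⟨β, rfl⟩ := ih₂
    exact ⟨α * β, mul_smul α β U⟩

lemma one_mem_iff_of_eqvGen_adj0 {A : Type u} [Group A] {S T : Set (Hol A)}
    (h : Relation.EqvGen adj0 S T) : (1 : Hol A) ∈ S ↔ (1 : Hol A) ∈ T := by
  induction h with
  | rel S T h => exact iff_of_true h.1.2 h.2.1.2
  | refl S => exact Iff.rfl
  | symm S T _ ih => exact ih.symm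
  | trans S T U _ _ ih₁ ih₂ => exact ih₁.trans ih₂

/-- Let `A` be a group and `𝒮` a nonempty family of regular
subsets of `Hol(A)` closed under the translations `α⁻¹S` (`α ∈ S ∈ 𝒮`), i.e. a
regular dynamical subgroup of `Hol(A)` indexed by itself, defining a dynamical skew
brace on `A`; let `Q` be its quiver (an arrow `S → trg S a` for each `a ∈ A`), and
let `𝒮_un` be the members containing `(1_A, id)`, `𝒮_in` the others. Then:
(i) if `S ∈ 𝒮_un` and `S' ∈ Ss⁰_A` lies in the same connected component of the
quiver of `Ss⁰_A` as `S`, then `S' ∈ 𝒮` (hence `S' ∈ 𝒮_un`);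
(ii) for `S ∈ 𝒮_in` and `S', S'' ∈ 𝒮_un` in the same connected component of `Q`,
there is a bijection `Q(S,S') ≃ Q(S',S'')`;
(iii) for such `S, S', S''`, there is a bijection `Q(S,S') ≃ Q(S,S'')`. -/
theorem family_of_regular_subsets_components {A : Type u} [Group A]
    (F : Set (Set (Hol A))) (hne : F.Nonempty)
    (hreg : ∀ S ∈ F, IsRegularSubset S)
    (hclosed : ∀ S ∈ F, ∀ α ∈ S, {β : Hol A | α * β ∈ S} ∈ F) :
    (∀ S S' : Set (Hol A), S ∈ F → (⟨1, 1⟩ : Hol A) ∈ S →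
      Relation.EqvGen adj0 S S' → S' ∈ F ∧ (⟨1, 1⟩ : Hol A) ∈ S') ∧
    (∀ S S' S'' : Set (Hol A), S ∈ F → (⟨1, 1⟩ : Hol A) ∉ S →
      S' ∈ F → (⟨1, 1⟩ : Hol A) ∈ S' → S'' ∈ F → (⟨1, 1⟩ : Hol A) ∈ S'' →
      Relation.EqvGen (adjF F) S S' → Relation.EqvGen (adjF F) S' S'' →
      Nonempty ({a : A // trg S a = S'} ≃ {a : A // trg S' a = S''})) ∧
    (∀ S S' S'' : Set (Hol A), S ∈ F → (⟨1, 1⟩ : Hol A) ∉ S →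
      S' ∈ F → (⟨1, 1⟩ : Hol A) ∈ S' → S'' ∈ F → (⟨1, 1⟩ : Hol A) ∈ S'' →
      Relation.EqvGen (adjF F) S S' → Relation.EqvGen (adjF F) S' S'' →
      Nonempty ({a : A // trg S a = S'} ≃ {a : A // trg S a = S''})) := by
  have hadj : ∀ S T, adjF F S T → IsRegularSubset S ∧ ∃ a, trg S a = T :=
    fun S T h => ⟨hreg S h.1, h.2.2⟩
  refine ⟨fun S S' hS h1 h => ?_, fun S S' S'' hS _ hS' h1' _ h1'' h h' => ?_,
    fun S S' S'' hS _ _ h1' _ h1'' h h' => ?_⟩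
  · have h1' : (1 : Hol A) ∈ S' := (one_mem_iff_of_eqvGen_adj0 h).1 h1
    obtain ⟨α, rfl⟩ := exists_smul_eq_of_eqvGen (fun S T h => ⟨h.1.1, h.2.2⟩) h
    exact ⟨by
      simpa only [Set.smul_mem_smul_set_iff, Set.ofPred_mem_eq, ← smul_eq_mul] using
        hclosed _ hS α (mem_of_smul_eq h1' rfl), h1'⟩
  · obtain ⟨α, hα⟩ := exists_smul_eq_of_eqvGen hadj h
    obtain ⟨β, hβ⟩ := exists_smul_eq_of_eqvGen hadj h'
    refine ⟨(arrowEquiv (hreg S hS) h1').symm.trans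
      (Equiv.trans ?_ (arrowEquiv (hreg S' hS') h1''))⟩
    refine ((Equiv.mulLeft α⁻¹).trans (Equiv.mulRight β)).subtypeEquiv fun γ => ?_
    simp [mul_smul, hβ, inv_smul_eq_iff, hα]
  · obtain ⟨β, hβ⟩ := exists_smul_eq_of_eqvGen hadj h'
    refine ⟨(arrowEquiv (hreg S hS) h1').symm.trans
      (Equiv.trans ?_ (arrowEquiv (hreg S hS) h1''))⟩
    refine (Equiv.mulRight β).subtypeEquiv fun γ => ?_
    simp [mul_smul, hβ]
end

section
/- Let A be a finite group and K a connected component of the quiver of Ss^0_A having exactly s vertices. Then the number of initial vertices R ∈ Ss_A∖Ss^0_A that have at least one arrow into K in the quiver of Ss_A equals s·(|Aut(A)| − 1). -/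
/-- The translate `(1, h) • S` of a subset of the holomorph. -/
def autTranslate {A : Type u} [Group A] (h : MulAut A) (S : Set (Hol A)) : Set (Hol A) :=
  {β : Hol A | (⟨1, h⁻¹⟩ : Hol A) * β ∈ S}

theorem mk_mul_mk_hol {A : Type u} [Group A] (a c : A) (f g : MulAut A) :
    (⟨a, f⟩ : Hol A) * ⟨c, g⟩ = ⟨a * f c, f * g⟩ := rfl

theorem mk_mem_autTranslate {A : Type u} [Group A] {h : MulAut A} {S : Set (Hol A)}
    {a : A} {f : MulAut A} :
    (⟨a, f⟩ : Hol A) ∈ autTranslate h S ↔ (⟨h⁻¹ a, h⁻¹ * f⟩ : Hol A) ∈ S := by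
  simp only [autTranslate, Set.mem_ofPred_eq, mk_mul_mk_hol, one_mul]

theorem mk_mem_autTranslate_one {A : Type u} [Group A] {S : Set (Hol A)}
    (hS : IsRegularSubset S) (h1 : (⟨1, 1⟩ : Hol A) ∈ S) {h f : MulAut A} :
    (⟨1, f⟩ : Hol A) ∈ autTranslate h S ↔ f = h := by
  rw [mk_mem_autTranslate, map_one]
  constructor
  · intro hf
    exact (inv_mul_eq_one.mp ((hS 1).unique hf h1)).symm
  · rintro rfl
    rwa [inv_mul_cancel]

theorem IsRegularSubset.autTranslate {A : Type u} [Group A] {S : Set (Hol A)}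
    (hS : IsRegularSubset S) (h : MulAut A) : IsRegularSubset (autTranslate h S) := by
  intro a
  obtain ⟨f, hf, hu⟩ := hS (h⁻¹ a)
  refine ⟨h * f, ?_, fun g hg => ?_⟩
  · simpa only [mk_mem_autTranslate, inv_mul_cancel_left] using hf
  · exact inv_mul_eq_iff_eq_mul.mp (hu _ (mk_mem_autTranslate.mp hg))

theorem mk_mem_trg {A : Type u} [Group A] {S : Set (Hol A)} (hS : IsRegularSubset S)
    {a : A} {f : MulAut A} (hf : (⟨a, f⟩ : Hol A) ∈ S) {c : A} {g : MulAut A} :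
    (⟨c, g⟩ : Hol A) ∈ trg S a ↔ (⟨a * f c, f * g⟩ : Hol A) ∈ S := by
  constructor
  · rintro ⟨f', hf', hm⟩
    obtain rfl := (hS a).unique hf' hf
    exact hm
  · exact fun hm => ⟨f, hf, hm⟩

theorem IsRegularSubset.trg {A : Type u} [Group A] {S : Set (Hol A)}
    (hS : IsRegularSubset S) (a : A) : IsRegularSubset (trg S a) := by
  intro c
  obtain ⟨f, hf, -⟩ := hS a
  obtain ⟨g, hg, hu⟩ := hS (a * f c)
  refine ⟨f⁻¹ * g, ?_, fun k hk => ?_⟩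
  · simpa only [mk_mem_trg hS hf, mul_inv_cancel_left] using hg
  · exact eq_inv_mul_of_mul_eq (hu _ ((mk_mem_trg hS hf).mp hk))

theorem one_mem_trg {A : Type u} [Group A] {S : Set (Hol A)}
    (hS : IsRegularSubset S) (a : A) : (⟨1, 1⟩ : Hol A) ∈ trg S a := by
  obtain ⟨f, hf, -⟩ := hS a
  simpa only [mk_mem_trg hS hf, map_one, mul_one] using hf

theorem trg_autTranslate_one {A : Type u} [Group A] {S : Set (Hol A)}
    (hS : IsRegularSubset S) (h1 : (⟨1, 1⟩ : Hol A) ∈ S) (h : MulAut A) :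
    trg (autTranslate h S) 1 = S := by
  ext ⟨c, g⟩
  rw [mk_mem_trg (hS.autTranslate h) ((mk_mem_autTranslate_one hS h1).mpr rfl),
    mk_mem_autTranslate, one_mul, MulAut.inv_apply_self, inv_mul_cancel_left]

theorem autTranslate_trg_one {A : Type u} [Group A] {R : Set (Hol A)}
    (hR : IsRegularSubset R) {h : MulAut A} (hh : (⟨1, h⟩ : Hol A) ∈ R) :
    autTranslate h (trg R 1) = R := by
  ext ⟨c, g⟩
  rw [mk_mem_autTranslate, mk_mem_trg hR hh, one_mul, MulAut.apply_inv_self,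
    mul_inv_cancel_left]

/-- Arrows compose: following the label `a` and then `c` amounts to following the label
`a * f^S_a c`. -/
theorem trg_trg {A : Type u} [Group A] {S : Set (Hol A)} (hS : IsRegularSubset S)
    {a : A} {f : MulAut A} (hf : (⟨a, f⟩ : Hol A) ∈ S) (c : A) :
    trg (trg S a) c = trg S (a * f c) := by
  obtain ⟨g, hg, -⟩ := hS.trg a c
  ext ⟨d, k⟩
  rw [mk_mem_trg (hS.trg a) hg, mk_mem_trg hS hf, mk_mem_trg hS ((mk_mem_trg hS hf).mp hg),
    map_mul, MulAut.mul_apply, mul_assoc, mul_assoc]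

theorem adj0_trg_trg {A : Type u} [Group A] {S : Set (Hol A)} (hS : IsRegularSubset S)
    (a b : A) : adj0 (trg S a) (trg S b) := by
  obtain ⟨f, hf, -⟩ := hS a
  refine ⟨⟨hS.trg a, one_mem_trg hS a⟩, ⟨hS.trg b, one_mem_trg hS b⟩, f⁻¹ (a⁻¹ * b), ?_⟩
  rw [trg_trg hS hf, MulAut.apply_inv_self, mul_inv_cancel_left]

/-- Let `A` be a finite group and `K` the connected component of a
vertex `S₀` in the quiver of `Ss⁰_A` (the regular subsets of `Hol(A)` containing
`(1_A, id)`), with exactly `s` vertices. Then the number of initial vertices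
`R ∈ Ss_A ∖ Ss⁰_A` (regular subsets not containing `(1_A, id)`) having at least one
arrow into `K` in the quiver of `Ss_A` equals `s · (|Aut(A)| − 1)`. -/
theorem card_initial_vertices_into_component {A : Type u} [Group A] [Fintype A]
    (S₀ : Set (Hol A)) (h₀ : IsRegularSubset S₀ ∧ (⟨1, 1⟩ : Hol A) ∈ S₀)
    (s : ℕ)
    (hs : Nat.card {S : Set (Hol A) //
        (IsRegularSubset S ∧ (⟨1, 1⟩ : Hol A) ∈ S) ∧ Relation.EqvGen adj0 S₀ S} = s) :
    Nat.card {R : Set (Hol A) // IsRegularSubset R ∧ (⟨1, 1⟩ : Hol A) ∉ R ∧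
        ∃ a : A, Relation.EqvGen adj0 S₀ (trg R a)} =
      s * (Nat.card (MulAut A) - 1) := by
  subst hs
  have hcard : Nat.card {h : MulAut A // h ≠ 1} = Nat.card (MulAut A) - 1 := by
    classical
    have := Fintype.ofFinite (MulAut A)
    simp [Nat.card_eq_fintype_card, Fintype.card_subtype_compl]
  rw [← hcard, ← Nat.card_prod]
  symm
  refine Nat.card_congr (Equiv.ofBijective (fun p => ⟨autTranslate p.2.1 p.1.1,
    p.1.2.1.1.autTranslate _, fun h => p.2.2 ((mk_mem_autTranslate_one p.1.2.1.1
      p.1.2.1.2).mp h).symm, 1, ?_⟩) ⟨?_, ?_⟩)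
  · rw [trg_autTranslate_one p.1.2.1.1 p.1.2.1.2]
    exact p.1.2.2
  · rintro ⟨⟨S, ⟨hS, h1⟩, _⟩, ⟨h, _⟩⟩ ⟨⟨S', ⟨hS', h1'⟩, _⟩, ⟨h', _⟩⟩ heq
    have heq : autTranslate h S = autTranslate h' S' := congrArg Subtype.val heq
    obtain rfl : S = S' := by
      rw [← trg_autTranslate_one hS h1 h, heq, trg_autTranslate_one hS' h1' h']
    obtain rfl : h = h' := by
      rw [← mk_mem_autTranslate_one hS h1, ← heq, mk_mem_autTranslate_one hS h1]
    rfl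
  · rintro ⟨R, hR, hn, a, ha⟩
    obtain ⟨h, hh, -⟩ := hR 1
    refine ⟨⟨⟨trg R 1, ⟨hR.trg 1, one_mem_trg hR 1⟩,
      ha.trans _ _ _ (.rel _ _ (adj0_trg_trg hR a 1))⟩, ⟨h, ?_⟩⟩, ?_⟩
    · rintro rfl
      exact hn hh
    · exact Subtype.ext (autTranslate_trg_one hR hh)
end

section
/- Let (G, {·_λ}, •) be a skew bracoid over Λ whose underlying quiver is connected. Then G admits a Matsumoto–Shimizu labelling. Consequently, G is isomorphic over Λ, as a skew bracoid, to the skew bracoid associated with a zero-symmetric dynamical skew brace (A, Λ, φ, ·, {•_λ}); that is, every connected braided groupoid is obtained, up to isomorphism, from a zero-symmetric dynamical skew brace. -/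
/-- A groupoid over `Λ`: a quiver with arrow set `G`, an associative multiplication
defined (meaningfully) on composable pairs, a unit loop at every vertex, and
two-sided inverses. -/
structure Gpd (Λ : Type u) (G : Type v) where
  s : G → Λ
  t : G → Λ
  mul : G → G → G
  s_mul : ∀ x y, t x = s y → s (mul x y) = s x
  t_mul : ∀ x y, t x = s y → t (mul x y) = t y
  massoc : ∀ x y z, t x = s y → t y = s z → mul (mul x y) z = mul x (mul y z)
  one : Λ → G
  s_one : ∀ l, s (one l) = l
  t_one : ∀ l, t (one l) = l
  mul_one : ∀ x, mul x (one (t x)) = x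
  one_mul : ∀ x, mul (one (s x)) x = x
  inv : G → G
  s_inv : ∀ x, s (inv x) = t x
  t_inv : ∀ x, t (inv x) = s x
  mul_inv : ∀ x, mul x (inv x) = one (s x)
  inv_mul : ∀ x, mul (inv x) x = one (t x)

/-- A skew bracoid over `Λ`: a groupoid `(G, •, {1_λ})` together with, for each
`λ ∈ Λ`, a group operation `·_λ` on `G(λ,Λ)` (with unit `1_λ`, which is forced by
the compatibility), satisfying the bracoid compatibility
`x • (y ·_{t x} z) = (x•y) ·_{s x} x⁻¹ ·_{s x} (x•z)` whenever `t x = s y = s z`.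
Equivalently, a braided groupoid. -/
structure SkewBracoid (Λ : Type u) (G : Type v) extends Gpd Λ G where
  vmul : G → G → G
  vinv : G → G
  s_vmul : ∀ x y, s y = s x → s (vmul x y) = s x
  s_vinv : ∀ x, s (vinv x) = s x
  vassoc : ∀ x y z, s y = s x → s z = s x → vmul (vmul x y) z = vmul x (vmul y z)
  vone_mul : ∀ x, vmul (one (s x)) x = x
  vmul_one : ∀ x, vmul x (one (s x)) = x
  vinv_mul : ∀ x, vmul (vinv x) x = one (s x)
  vmul_inv : ∀ x, vmul x (vinv x) = one (s x)
  compat : ∀ x y z, t x = s y → s z = s y →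
    mul x (vmul y z) = vmul (mul x y) (vmul (vinv x) (mul x z))

/-- The product `·_λ` as an operation on the set `G(λ,Λ)` of arrows with source `λ`. -/
def vprod {Λ : Type u} {G : Type v} (B : SkewBracoid Λ G) (l : Λ)
    (u v : {x : G // B.s x = l}) : {x : G // B.s x = l} :=
  ⟨B.vmul u.val v.val, (B.s_vmul u.val v.val (v.2.trans u.2.symm)).trans u.2⟩

/-- A dynamical skew brace over `Λ` (group structure given by explicit data): a set
`A` with a transition map `φ`, a group structure `(A, gmul, gone, ginv)`, and left
quasigroup operations `•_λ` satisfying the dynamical associativity and the brace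
compatibility. -/
structure DynSkewBrace' (Λ : Type u) (A : Type v) where
  phi : Λ → A → Λ
  gmul : A → A → A
  gone : A
  ginv : A → A
  gassoc : ∀ a b c, gmul (gmul a b) c = gmul a (gmul b c)
  gone_mul : ∀ a, gmul gone a = a
  gmul_one : ∀ a, gmul a gone = a
  ginv_mul : ∀ a, gmul (ginv a) a = gone
  bull : Λ → A → A → A
  bull_bij : ∀ l a, Function.Bijective (bull l a)
  dassoc : ∀ l a b c, bull l a (bull (phi l a) b c) = bull l (bull l a b) c
  compat : ∀ l a b c,
    bull l a (gmul b c) = gmul (bull l a b) (gmul (ginv a) (bull l a c))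

namespace Gpd

variable {Λ : Type u} {G : Type v} (B : Gpd Λ G)

theorem inv_mul_cancel_left {x y : G} (h : B.t x = B.s y) : B.mul (B.inv x) (B.mul x y) = y := by
  rw [← B.massoc _ _ _ (B.t_inv x) h, B.inv_mul, h, B.one_mul]

theorem mul_inv_cancel_left {x y : G} (h : B.s x = B.s y) : B.mul x (B.mul (B.inv x) y) = y := by
  rw [← B.massoc _ _ _ (B.s_inv x).symm ((B.t_inv x).trans h), B.mul_inv, h, B.one_mul]

/-- In a connected groupoid any two vertices are joined by an arrow. -/
theorem exists_arrow_of_eqvGen {l m : Λ}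
    (h : Relation.EqvGen (fun l m => ∃ x : G, B.s x = l ∧ B.t x = m) l m) :
    ∃ x : G, B.s x = l ∧ B.t x = m := by
  induction h with
  | rel _ _ h => exact h
  | refl l => exact ⟨B.one l, B.s_one l, B.t_one l⟩
  | symm _ _ _ ih =>
    obtain ⟨x, hs, ht⟩ := ih
    exact ⟨B.inv x, (B.s_inv x).trans ht, (B.t_inv x).trans hs⟩
  | trans _ _ _ _ _ ih₁ ih₂ =>
    obtain ⟨x, hs, ht⟩ := ih₁
    obtain ⟨y, hs', ht'⟩ := ih₂
    have h := ht.trans hs'.symm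
    exact ⟨B.mul x y, (B.s_mul x y h).trans hs, (B.t_mul x y h).trans ht'⟩

end Gpd

namespace SkewBracoid

variable {Λ : Type u} {G : Type v} (B : SkewBracoid Λ G)

theorem vinv_vmul_cancel_left {x y : G} (h : B.s y = B.s x) :
    B.vmul (B.vinv x) (B.vmul x y) = y := by
  rw [← B.vassoc _ _ _ (B.s_vinv x).symm (h.trans (B.s_vinv x).symm), B.vinv_mul, ← h, B.vone_mul]

theorem vmul_vinv_cancel_left {x y : G} (h : B.s y = B.s x) :
    B.vmul x (B.vmul (B.vinv x) y) = y := by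
  rw [← B.vassoc _ _ _ (B.s_vinv x) h, B.vmul_inv, ← h, B.vone_mul]

theorem eq_one_of_vmul_self {x : G} (h : B.vmul x x = x) : x = B.one (B.s x) := by
  have := B.vinv_vmul_cancel_left (x := x) rfl
  rwa [h, B.vinv_mul, eq_comm] at this

theorem eq_vinv_of_vmul_eq_one {x y : G} (hs : B.s y = B.s x)
    (h : B.vmul x y = B.one (B.s x)) : y = B.vinv x := by
  rw [← B.vinv_vmul_cancel_left hs, h, ← B.s_vinv x, B.vmul_one]

/-- The map `z ↦ x⁻¹ ·_{s x} (x • z)`, as a bijection from the arrows with source `t x` to the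
arrows with source `s x`. -/
def gamma {l m : Λ} (x : G) (hs : B.s x = l) (ht : B.t x = m) :
    {z : G // B.s z = m} ≃ {z : G // B.s z = l} where
  toFun z := ⟨B.vmul (B.vinv x) (B.mul x z), by
    have := z.2
    rw [B.s_vmul, B.s_vinv, hs]
    rw [B.s_mul _ _ (by grind), B.s_vinv]⟩
  invFun z := ⟨B.mul (B.inv x) (B.vmul x z), by
    have := z.2
    rw [B.s_mul, B.s_inv, ht]
    rw [B.t_inv, B.s_vmul _ _ (by grind)]⟩
  left_inv z := by
    have := z.2
    have h : B.t x = B.s z.1 := by grind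
    apply Subtype.ext
    dsimp only
    rw [B.vmul_vinv_cancel_left (B.s_mul _ _ h), B.inv_mul_cancel_left h]
  right_inv z := by
    have := z.2
    have h : B.s z.1 = B.s x := by grind
    apply Subtype.ext
    dsimp only
    rw [B.mul_inv_cancel_left (B.s_vmul _ _ h).symm, B.vinv_vmul_cancel_left h]

theorem gamma_vprod {l m : Λ} (x : G) (hs : B.s x = l) (ht : B.t x = m)
    (y z : {z : G // B.s z = m}) :
    B.gamma x hs ht (vprod B m y z) = vprod B l (B.gamma x hs ht y) (B.gamma x hs ht z) := by
  obtain ⟨y, hy⟩ := y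
  obtain ⟨z, hz⟩ := z
  apply Subtype.ext
  dsimp only [gamma, vprod, Equiv.coe_fn_mk]
  have hxy := B.s_mul x y (ht.trans hy.symm)
  have hxz := B.s_mul x z (ht.trans hz.symm)
  have hx := B.s_vinv x
  have h := B.s_vmul (B.vinv x) (B.mul x z) (hxz.trans hx.symm)
  rw [B.compat x y z (ht.trans hy.symm) (hz.trans hy.symm),
    B.vassoc _ _ _ (hxy.trans hx.symm) h]

/-- A labelling is Matsumoto–Shimizu if the induced group operation on labels does not depend on
the vertex. -/
def IsMatsumotoShimizu {B : SkewBracoid Λ G} {A : Type v}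
    (lab : ∀ l : Λ, {x : G // B.s x = l} ≃ A) : Prop :=
  ∀ (l l' : Λ) (a b : A),
    lab l (vprod B l ((lab l).symm a) ((lab l).symm b)) =
    lab l' (vprod B l' ((lab l').symm a) ((lab l').symm b))

/-- A connected skew bracoid admits a Matsumoto–Shimizu labelling. -/
theorem exists_labelling [Nonempty Λ]
    (hconn : ∀ l m : Λ,
      Relation.EqvGen (fun l m => ∃ x : G, B.s x = l ∧ B.t x = m) l m) :
    ∃ (A : Type v) (lab : ∀ l : Λ, {x : G // B.s x = l} ≃ A),
      IsMatsumotoShimizu lab := by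
  obtain ⟨o⟩ := ‹Nonempty Λ›
  choose p hs ht using fun l => B.exists_arrow_of_eqvGen (hconn o l)
  refine ⟨{x : G // B.s x = o}, fun l => B.gamma (p l) (hs l) (ht l), fun l l' a b => ?_⟩
  simp only [gamma_vprod, Equiv.apply_symm_apply]

section Labelling

variable {B} {A : Type v} (lab : ∀ l : Λ, {x : G // B.s x = l} ≃ A)

/-- The label of an arrow. -/
def label (x : G) : A := lab (B.s x) ⟨x, rfl⟩

/-- The arrow with given source and label. -/
def arrow (l : Λ) (a : A) : G := ((lab l).symm a).1

theorem s_arrow (l : Λ) (a : A) : B.s (arrow lab l a) = l := ((lab l).symm a).2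

theorem label_eq {l : Λ} (x : {x : G // B.s x = l}) : label lab x.1 = lab l x := by
  obtain ⟨x, rfl⟩ := x
  rfl

theorem label_arrow (l : Λ) (a : A) : label lab (arrow lab l a) = a := by
  rw [arrow, label_eq, Equiv.apply_symm_apply]

theorem arrow_label {l : Λ} {x : G} (h : B.s x = l) : arrow lab l (label lab x) = x := by
  subst h
  rw [arrow, label, Equiv.symm_apply_apply]

theorem arrow_injective (l : Λ) : Function.Injective (arrow lab l) :=
  Function.LeftInverse.injective (label_arrow lab l)

/-- The multiplication on labels induced by the vertex group at `o`. -/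
def labelMul (o : Λ) (a b : A) : A := label lab (B.vmul (arrow lab o a) (arrow lab o b))

/-- The operation `•_l` on labels induced by the groupoid multiplication. -/
def labelBull (l : Λ) (a b : A) : A :=
  label lab (B.mul (arrow lab l a) (arrow lab (B.t (arrow lab l a)) b))

theorem arrow_labelBull (l : Λ) (a b : A) :
    arrow lab l (labelBull lab l a b) =
      B.mul (arrow lab l a) (arrow lab (B.t (arrow lab l a)) b) :=
  arrow_label lab ((B.s_mul _ _ (s_arrow lab _ b).symm).trans (s_arrow lab l a))

theorem labelBull_bijective (l : Λ) (a : A) : Function.Bijective (labelBull lab l a) := by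
  constructor
  · intro b c h
    have h := congrArg (arrow lab l) h
    rw [arrow_labelBull, arrow_labelBull] at h
    have h := congrArg (B.mul (B.inv (arrow lab l a))) h
    rw [B.inv_mul_cancel_left (s_arrow lab _ b).symm,
      B.inv_mul_cancel_left (s_arrow lab _ c).symm] at h
    exact arrow_injective lab _ h
  · intro c
    have hs : B.s (arrow lab l a) = B.s (arrow lab l c) := by simp only [s_arrow]
    refine ⟨label lab (B.mul (B.inv (arrow lab l a)) (arrow lab l c)), ?_⟩
    apply arrow_injective lab l
    rw [arrow_labelBull, arrow_label, B.mul_inv_cancel_left hs]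
    rw [B.s_mul _ _ ((B.t_inv _).trans hs), B.s_inv]

variable {lab}

theorem arrow_labelMul (hlab : IsMatsumotoShimizu lab) (o l : Λ) (a b : A) :
    arrow lab l (labelMul lab o a b) = B.vmul (arrow lab l a) (arrow lab l b) := by
  have h : labelMul lab o a b = label lab (B.vmul (arrow lab l a) (arrow lab l b)) := by
    have := hlab o l a b
    rwa [← label_eq, ← label_eq] at this
  rw [h, arrow_label]
  rw [B.s_vmul _ _ (by simp only [s_arrow]), s_arrow]

theorem arrow_label_one (hlab : IsMatsumotoShimizu lab) (o l : Λ) :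
    arrow lab l (label lab (B.one o)) = B.one l := by
  have hone : B.vmul (B.one o) (B.one o) = B.one o := by
    simpa only [B.s_one] using B.vone_mul (B.one o)
  have h := B.eq_one_of_vmul_self (x := arrow lab l (label lab (B.one o))) (by
    rw [← arrow_labelMul hlab o, labelMul, arrow_label lab (B.s_one o), hone])
  rwa [s_arrow] at h

theorem arrow_label_vinv (hlab : IsMatsumotoShimizu lab) (o l : Λ) (a : A) :
    arrow lab l (label lab (B.vinv (arrow lab o a))) = B.vinv (arrow lab l a) := by
  apply B.eq_vinv_of_vmul_eq_one
  · simp only [s_arrow]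
  · rw [← arrow_labelMul hlab o, labelMul, arrow_label lab ((B.s_vinv _).trans (s_arrow lab o a)),
      B.vmul_inv, s_arrow, s_arrow, arrow_label_one hlab]

/-- The dynamical skew brace on the labels of a Matsumoto–Shimizu labelling; the vertex `o` serves
to name the group operation. -/
def dynSkewBrace (hlab : IsMatsumotoShimizu lab) (o : Λ) : DynSkewBrace' Λ A where
  phi l a := B.t (arrow lab l a)
  gmul := labelMul lab o
  gone := label lab (B.one o)
  ginv a := label lab (B.vinv (arrow lab o a))
  gassoc a b c := arrow_injective lab o <| by
    simp only [arrow_labelMul hlab]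
    exact B.vassoc _ _ _ (by simp only [s_arrow]) (by simp only [s_arrow])
  gone_mul a := arrow_injective lab o <| by
    rw [arrow_labelMul hlab, arrow_label_one hlab]
    simpa only [s_arrow] using B.vone_mul (arrow lab o a)
  gmul_one a := arrow_injective lab o <| by
    rw [arrow_labelMul hlab, arrow_label_one hlab]
    simpa only [s_arrow] using B.vmul_one (arrow lab o a)
  ginv_mul a := arrow_injective lab o <| by
    rw [arrow_labelMul hlab, arrow_label_vinv hlab, arrow_label_one hlab, B.vinv_mul, s_arrow]
  bull := labelBull lab
  bull_bij := labelBull_bijective lab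
  dassoc l a b c := arrow_injective lab l <| by
    have h := (s_arrow lab (B.t (arrow lab l a)) b).symm
    rw [arrow_labelBull, arrow_labelBull, arrow_labelBull, arrow_labelBull, B.t_mul _ _ h,
      B.massoc _ _ _ h (s_arrow lab _ c).symm]
  compat l a b c := arrow_injective lab l <| by
    simp only [arrow_labelMul hlab, arrow_labelBull, arrow_label_vinv hlab]
    exact B.compat _ _ _ (s_arrow lab _ b).symm (by simp only [s_arrow])

theorem dynSkewBrace_bull_gone (hlab : IsMatsumotoShimizu lab) (o l : Λ) (a : A) :
    (dynSkewBrace hlab o).bull l (dynSkewBrace hlab o).gone a = a := by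
  apply arrow_injective lab l
  refine (arrow_labelBull lab l _ a).trans ?_
  change B.mul (arrow lab l (label lab (B.one o)))
    (arrow lab (B.t (arrow lab l (label lab (B.one o)))) a) = _
  rw [arrow_label_one hlab, B.t_one]
  simpa only [s_arrow] using B.one_mul (arrow lab l a)

variable (lab) in
/-- An arrow is determined by its source and its label. -/
def sourceLabelEquiv : G ≃ Λ × A where
  toFun x := (B.s x, label lab x)
  invFun p := arrow lab p.1 p.2
  left_inv _ := arrow_label lab rfl
  right_inv p := Prod.ext (s_arrow lab p.1 p.2) (label_arrow lab p.1 p.2)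

end Labelling

end SkewBracoid

/-- Let `(G, {·_λ}, •)` be a skew bracoid over `Λ` whose underlying
quiver is connected. Then `G` admits a Matsumoto–Shimizu labelling: a family of
bijections `lab_λ : G(λ,Λ) ≃ A` such that the induced group operation on `A` is
independent of `λ`. Consequently, `G` is isomorphic over `Λ`, as a skew bracoid, to
the skew bracoid associated with a zero-symmetric dynamical skew brace
`(A, Λ, φ, ·, {•_λ})`: there is a bijection `e : G ≃ Λ × A` commuting with sources,
targets, the groupoid multiplication and the vertex group operations. -/
theorem connected_skewBracoid_is_dynSkewBrace {Λ : Type u} {G : Type v}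
    [Nonempty Λ] (B : SkewBracoid Λ G)
    (hconn : ∀ l m : Λ,
      Relation.EqvGen (fun l m => ∃ x : G, B.s x = l ∧ B.t x = m) l m) :
    -- G admits a Matsumoto–Shimizu labelling
    (∃ (A : Type v) (lab : ∀ l : Λ, {x : G // B.s x = l} ≃ A),
      ∀ (l l' : Λ) (a b : A),
        lab l (vprod B l ((lab l).symm a) ((lab l).symm b)) =
        lab l' (vprod B l' ((lab l').symm a) ((lab l').symm b))) ∧
    -- G is isomorphic over Λ to a zero-symmetric dynamical skew brace
    (∃ (A : Type v) (D : DynSkewBrace' Λ A) (e : G ≃ Λ × A),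
      (∀ (l : Λ) (a : A), D.bull l D.gone a = a) ∧
      (∀ x : G, (e x).1 = B.s x) ∧
      (∀ x : G, D.phi (e x).1 (e x).2 = B.t x) ∧
      (∀ x y : G, B.t x = B.s y →
        e (B.mul x y) = ((e x).1, D.bull (e x).1 (e x).2 (e y).2)) ∧
      (∀ x y : G, B.s y = B.s x →
        e (B.vmul x y) = ((e x).1, D.gmul (e x).2 (e y).2))) := by
  obtain ⟨A, lab, hlab⟩ := B.exists_labelling hconn
  refine ⟨⟨A, lab, hlab⟩, ?_⟩
  obtain ⟨o⟩ := ‹Nonempty Λ›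
  refine ⟨A, SkewBracoid.dynSkewBrace hlab o, SkewBracoid.sourceLabelEquiv lab,
    SkewBracoid.dynSkewBrace_bull_gone hlab o, fun x => rfl,
    fun x => congrArg B.t (SkewBracoid.arrow_label lab rfl), fun x y h => ?_, fun x y h => ?_⟩
  · refine Prod.ext (B.s_mul x y h) (congrArg (SkewBracoid.label lab) ?_)
    change _ = B.mul (SkewBracoid.arrow lab (B.s x) (SkewBracoid.label lab x))
      (SkewBracoid.arrow lab (B.t (SkewBracoid.arrow lab (B.s x) (SkewBracoid.label lab x)))
        (SkewBracoid.label lab y))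
    rw [SkewBracoid.arrow_label lab rfl, SkewBracoid.arrow_label lab h.symm]
  · refine Prod.ext (B.s_vmul x y h) (SkewBracoid.arrow_injective lab (B.s x) ?_)
    refine (SkewBracoid.arrow_label lab (B.s_vmul x y h)).trans ?_
    refine Eq.trans ?_ (SkewBracoid.arrow_labelMul hlab o (B.s x) _ _).symm
    change _ = B.vmul (SkewBracoid.arrow lab (B.s x) (SkewBracoid.label lab x))
      (SkewBracoid.arrow lab (B.s x) (SkewBracoid.label lab y))
    rw [SkewBracoid.arrow_label lab rfl, SkewBracoid.arrow_label lab h]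
end

section
/- Let Λ be a nonempty set, G the groupoid of pairs over Λ, and σ a braiding on G, with associated heap operation ⟨−,−,−⟩ on Λ determined by σ([a,b]⊗[b,c]) = [a,⟨a,b,c⟩]⊗[⟨a,b,c⟩,c]. Write σ(x⊗y) = (x⇀y)⊗(x↼y); the maps x⇀(−) : G(t(x),Λ) → G(s(x),Λ) are bijective. Fix ζ ∈ Λ and define, for a,b ∈ Λ, the product [ζ,a] ∗ [ζ,b] := [ζ,a] • (([ζ,a]⇀(−))^{-1}([ζ,b])) (the vertex group operation at ζ of the skew bracoid corresponding to σ). Then [ζ,a] ∗ [ζ,b] = [ζ, ⟨a,ζ,b⟩] for all a,b ∈ Λ; i.e., the group operation on Λ induced by the standard Matsumoto–Shimizu labelling at ζ coincides with the group operation a·b := ⟨a,ζ,b⟩ obtained from the heap with unit ζ. -/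
/-- Let `G` be the groupoid of pairs over a nonempty set `Λ`, `σ` a
braiding on `G` with associated heap operation `T` (so
`σ([a,b]⊗[b,c]) = [a, T a b c]⊗[T a b c, c]`), and fix `ζ ∈ Λ`. The vertex group
operation at `ζ` of the corresponding skew bracoid is
`[ζ,a] ∗ [ζ,b] := [ζ,a] • (([ζ,a] ⇀ (−))⁻¹ ([ζ,b]))`; i.e. if `z` is the arrow with
source `t([ζ,a]) = a` such that `[ζ,a] ⇀ z = [ζ,b]`, then `[ζ,a] ∗ [ζ,b] = [ζ,a] • z`.
The claim: `[ζ,a] ∗ [ζ,b] = [ζ, T a ζ b]`, i.e. the group operation on `Λ` induced by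
the standard Matsumoto–Shimizu labelling at `ζ` is the group operation
`a·b = ⟨a,ζ,b⟩` of the heap pointed at `ζ`. -/
theorem pair_bracoid_vertex_group_is_heap_group {Λ : Type u} [Nonempty Λ]
    (T : Λ → Λ → Λ → Λ) (hT : IsPairBraiding T) (ζ a b : Λ) (z : Λ × Λ)
    (hz1 : z.1 = a) (hz2 : rhT T (ζ, a) z = ((ζ : Λ), b)) :
    pmul ((ζ : Λ), a) z = ((ζ : Λ), T a ζ b) := by
  obtain ⟨-, -, hunit, -, hmul, -⟩ := hT
  obtain ⟨z₁, c⟩ := z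
  obtain rfl : z₁ = a := hz1
  have hb : T ζ z₁ c = b := congrArg Prod.snd hz2
  have h1 : T z₁ z₁ c = c := congrArg Prod.snd (hunit (z₁, c)).1
  have h2 : T z₁ z₁ c = T z₁ ζ (T ζ z₁ c) :=
    congrArg Prod.snd (hmul (z₁, ζ) (ζ, z₁) (z₁, c) rfl rfl).1
  change (ζ, c) = (ζ, T z₁ ζ b)
  rw [← hb, ← h2, h1]
end
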